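/- Let C ⊆ ℝ^d be a pointed rational polyhedral cone, let P ⊆ ℝ^d be a C-compatible polytope, let n be a positive integer, and let τ be a truncated addition table over n elements. Then the set P_τ^{(C,P)} ⊆ (ℝ^d)^n is a finite union of bounded sets, each of which is the solution set of finitely many linear inequalities with rational coefficients, each inequality being either strict or non-strict (i.e., each is a rational polytope with mixed open and closed faces). -/

import Mathlib

open Pointwise

/-- The real vector in ℝ^d corresponding to an integer lattice point. -/
def intVec {d : ℕ} (x : Fin d → ℤ) : Fin d → ℝ := fun i => (x i : ℝ)

/-- A rational polyhedral cone: the set of nonnegative real linear combinations of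
finitely many integer vectors. -/
def IsRationalPolyhedralCone {d : ℕ} (C : Set (Fin d → ℝ)) : Prop :=
  ∃ (k : ℕ) (v : Fin k → Fin d → ℝ), (∀ i j, ∃ z : ℤ, v i j = (z : ℝ)) ∧
    C = {x | ∃ c : Fin k → ℝ, (∀ i, 0 ≤ c i) ∧ x = ∑ i, c i • v i}

/-- A cone is pointed if `C ∩ (−C) = {0}`. -/
def IsPointed {d : ℕ} (C : Set (Fin d → ℝ)) : Prop := C ∩ (-C) = {0}

/-- A rational polytope: the convex hull of finitely many rational points. -/
def IsRationalPolytope {d : ℕ} (P : Set (Fin d → ℝ)) : Prop :=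
  ∃ (k : ℕ) (v : Fin k → Fin d → ℝ), (∀ i j, ∃ q : ℚ, v i j = (q : ℝ)) ∧
    P = convexHull ℝ (Set.range v)

/-- `P` contains a neighborhood of the origin in `C`. -/
def ContainsConeNbhdOfZero {d : ℕ} (C P : Set (Fin d → ℝ)) : Prop :=
  ∃ ε : ℝ, 0 < ε ∧ ∀ x ∈ C, (∀ i, |x i| < ε) → x ∈ P

/-- `P` is a `C`-compatible polytope: a rational polytope containing a neighborhood of
the origin in `C` such that for every `x ∈ C \ P`, `x + C ⊆ C \ P`. -/
def IsCCompatible {d : ℕ} (C P : Set (Fin d → ℝ)) : Prop :=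
  IsRationalPolytope P ∧ ContainsConeNbhdOfZero C P ∧
    ∀ x ∈ C \ P, ∀ y ∈ C, x + y ∈ C \ P

/-- Lexicographic order on ℝ^d. -/
def lexLt {d : ℕ} (x y : Fin d → ℝ) : Prop :=
  ∃ i : Fin d, (∀ j, j < i → x j = y j) ∧ x i < y i

/-- The set `P_τ^{(C,P)} ⊆ (ℝ^d)^n` associated to a truncated addition table `τ`
(`τ i j = none` encodes the value ∞). -/
def AffineSRSet (d n : ℕ) (C P : Set (Fin d → ℝ))
    (τ : Fin n → Fin n → Option (Fin n)) : Set (Fin n → Fin d → ℝ) :=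
  {x | (∀ i j : Fin n, i < j → lexLt (x i) (x j)) ∧
    (∀ i, x i ∈ C ∧ x i ≠ 0) ∧ (∀ i, x i ∈ P) ∧
    (∀ i j k, τ i j = some k → x i + x j = x k) ∧
    (∀ i j, τ i j = none → x i + x j ∉ P)}

section Semilinear

variable {ι κ : Type*} [Fintype ι] [Fintype κ]

/-- Affine functionals on `ℝ^ι` with rational coefficients. -/
def IsRatAffine (f : (ι → ℝ) → ℝ) : Prop :=
  ∃ (a : ι → ℚ) (b : ℚ), ∀ x, f x = ∑ i, (a i : ℝ) * x i + b

namespace IsRatAffine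

lemma const (q : ℚ) : IsRatAffine fun _ : ι → ℝ => (q : ℝ) :=
  ⟨0, q, by simp⟩

lemma zero : IsRatAffine fun _ : ι → ℝ => (0 : ℝ) := by
  simpa using const (ι := ι) 0

lemma one : IsRatAffine fun _ : ι → ℝ => (1 : ℝ) := by
  simpa using const (ι := ι) 1

lemma coord (i : ι) : IsRatAffine fun x : ι → ℝ => x i := by
  classical
  exact ⟨Pi.single i 1, 0, fun x => by simp [Pi.single_apply, apply_ite (Rat.cast : ℚ → ℝ)]⟩

lemma add {f g : (ι → ℝ) → ℝ} (hf : IsRatAffine f) (hg : IsRatAffine g) :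
    IsRatAffine fun x => f x + g x := by
  obtain ⟨a, b, h⟩ := hf
  obtain ⟨a', b', h'⟩ := hg
  refine ⟨a + a', b + b', fun x => ?_⟩
  simp only [h, h', Pi.add_apply, Rat.cast_add, add_mul, Finset.sum_add_distrib]
  ring

lemma const_mul {f : (ι → ℝ) → ℝ} (q : ℚ) (hf : IsRatAffine f) :
    IsRatAffine fun x => (q : ℝ) * f x := by
  obtain ⟨a, b, h⟩ := hf
  refine ⟨fun i => q * a i, q * b, fun x => ?_⟩
  simp only [h, Rat.cast_mul, mul_add, Finset.mul_sum, mul_assoc]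

lemma neg {f : (ι → ℝ) → ℝ} (hf : IsRatAffine f) : IsRatAffine fun x => -f x := by
  simpa using hf.const_mul (-1)

lemma sub {f g : (ι → ℝ) → ℝ} (hf : IsRatAffine f) (hg : IsRatAffine g) :
    IsRatAffine fun x => f x - g x := by
  simpa only [sub_eq_add_neg] using hf.add hg.neg

lemma sum {α : Type*} (s : Finset α) {f : α → (ι → ℝ) → ℝ} (hf : ∀ j, IsRatAffine (f j)) :
    IsRatAffine fun x => ∑ j ∈ s, f j x := by
  classical
  induction s using Finset.induction_on with
  | empty => simpa using zero
  | insert j s hj ih => simpa only [Finset.sum_insert hj] using (hf j).add ih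

lemma comp {f : (κ → ℝ) → ℝ} (hf : IsRatAffine f) {φ : (ι → ℝ) → κ → ℝ}
    (hφ : ∀ j, IsRatAffine fun x => φ x j) : IsRatAffine fun x => f (φ x) := by
  obtain ⟨a, b, h⟩ := hf
  simp only [h]
  exact (sum _ fun j => (hφ j).const_mul (a j)).add (const b)

/-- Along a coordinate line a rational affine functional is affine with rational slope. -/
lemma exists_update_eq [DecidableEq ι] {f : (ι → ℝ) → ℝ} (hf : IsRatAffine f) (i : ι) :
    ∃ (q : ℚ) (r : (ι → ℝ) → ℝ), IsRatAffine r ∧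
      ∀ x t, f (Function.update x i t) = q * t + r x := by
  obtain ⟨a, b, h⟩ := hf
  refine ⟨a i, fun x => f (Function.update x i 0), ?_, fun x t => ?_⟩
  · refine comp ⟨a, b, h⟩ fun j => ?_
    by_cases hj : j = i
    · subst hj
      simpa using zero
    · simpa [hj] using coord j
  · simp only [h, ← Finset.add_sum_erase _ _ (Finset.mem_univ i), Function.update_self]
    have : ∀ s : ℝ, ∑ j ∈ Finset.univ.erase i, (a j : ℝ) * Function.update x i s j
        = ∑ j ∈ Finset.univ.erase i, (a j : ℝ) * x j := fun s =>
      Finset.sum_congr rfl fun j hj => by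
        rw [Function.update_of_ne (Finset.ne_of_mem_erase hj)]
    rw [this, this]
    ring

end IsRatAffine

/-- Open and closed halfspaces with rational coefficients; degenerate ones are allowed. -/
def IsRatHalfspace (H : Set (ι → ℝ)) : Prop :=
  ∃ f, IsRatAffine f ∧ (H = {x | f x < 0} ∨ H = {x | f x ≤ 0})

/-- Finite intersections of rational halfspaces. -/
def IsRatPolyhedron (B : Set (ι → ℝ)) : Prop :=
  ∃ F : Set (Set (ι → ℝ)), F.Finite ∧ (∀ H ∈ F, IsRatHalfspace H) ∧ B = ⋂₀ F

/-- Finite unions of finite intersections of rational halfspaces. -/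
def IsSemilinear (S : Set (ι → ℝ)) : Prop :=
  ∃ G : Set (Set (ι → ℝ)), G.Finite ∧ (∀ B ∈ G, IsRatPolyhedron B) ∧ S = ⋃₀ G

lemma IsRatHalfspace.compl {H : Set (ι → ℝ)} (h : IsRatHalfspace H) : IsRatHalfspace Hᶜ := by
  obtain ⟨f, hf, rfl | rfl⟩ := h
  · refine ⟨_, hf.neg, Or.inr ?_⟩
    ext x; simp
  · refine ⟨_, hf.neg, Or.inl ?_⟩
    ext x; simp

lemma IsRatHalfspace.preimage {H : Set (κ → ℝ)} (h : IsRatHalfspace H) {φ : (ι → ℝ) → κ → ℝ}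
    (hφ : ∀ j, IsRatAffine fun x => φ x j) : IsRatHalfspace (φ ⁻¹' H) := by
  obtain ⟨f, hf, rfl | rfl⟩ := h
  · exact ⟨_, hf.comp hφ, Or.inl rfl⟩
  · exact ⟨_, hf.comp hφ, Or.inr rfl⟩

lemma IsRatHalfspace.isRatPolyhedron {H : Set (ι → ℝ)} (h : IsRatHalfspace H) :
    IsRatPolyhedron H :=
  ⟨{H}, Set.finite_singleton H, by simpa using h, by simp⟩

lemma IsRatPolyhedron.inter {A B : Set (ι → ℝ)} (hA : IsRatPolyhedron A)
    (hB : IsRatPolyhedron B) : IsRatPolyhedron (A ∩ B) := by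
  obtain ⟨F, hF, h, rfl⟩ := hA
  obtain ⟨F', hF', h', rfl⟩ := hB
  exact ⟨F ∪ F', hF.union hF', fun H hH => hH.elim (h H) (h' H), (Set.sInter_union F F').symm⟩

lemma IsRatPolyhedron.isSemilinear {B : Set (ι → ℝ)} (h : IsRatPolyhedron B) :
    IsSemilinear B :=
  ⟨{B}, Set.finite_singleton B, by simpa using h, by simp⟩

lemma IsRatHalfspace.isSemilinear {H : Set (ι → ℝ)} (h : IsRatHalfspace H) : IsSemilinear H :=
  h.isRatPolyhedron.isSemilinear

namespace IsSemilinear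

lemma lt {f g : (ι → ℝ) → ℝ} (hf : IsRatAffine f) (hg : IsRatAffine g) :
    IsSemilinear {x | f x < g x} :=
  IsRatHalfspace.isSemilinear ⟨_, hf.sub hg, Or.inl (by ext x; simp)⟩

lemma le {f g : (ι → ℝ) → ℝ} (hf : IsRatAffine f) (hg : IsRatAffine g) :
    IsSemilinear {x | f x ≤ g x} :=
  IsRatHalfspace.isSemilinear ⟨_, hf.sub hg, Or.inr (by ext x; simp)⟩

lemma empty : IsSemilinear (∅ : Set (ι → ℝ)) :=
  ⟨∅, Set.finite_empty, by simp, by simp⟩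

lemma univ : IsSemilinear (Set.univ : Set (ι → ℝ)) :=
  IsRatPolyhedron.isSemilinear ⟨∅, Set.finite_empty, by simp, by simp⟩

lemma union {S T : Set (ι → ℝ)} (hS : IsSemilinear S) (hT : IsSemilinear T) :
    IsSemilinear (S ∪ T) := by
  obtain ⟨G, hG, h, rfl⟩ := hS
  obtain ⟨G', hG', h', rfl⟩ := hT
  exact ⟨G ∪ G', hG.union hG', fun H hH => hH.elim (h H) (h' H), (Set.sUnion_union G G').symm⟩

lemma inter {S T : Set (ι → ℝ)} (hS : IsSemilinear S) (hT : IsSemilinear T) :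
    IsSemilinear (S ∩ T) := by
  obtain ⟨G, hG, h, rfl⟩ := hS
  obtain ⟨G', hG', h', rfl⟩ := hT
  refine ⟨Set.image2 (· ∩ ·) G G', hG.image2 _ hG', ?_, ?_⟩
  · rintro _ ⟨A, hA, B, hB, rfl⟩
    exact (h A hA).inter (h' B hB)
  · ext x
    simp only [Set.mem_inter_iff, Set.mem_sUnion, Set.mem_image2]
    constructor
    · rintro ⟨⟨A, hA, hxA⟩, B, hB, hxB⟩
      exact ⟨_, ⟨A, hA, B, hB, rfl⟩, hxA, hxB⟩
    · rintro ⟨_, ⟨A, hA, B, hB, rfl⟩, hxA, hxB⟩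
      exact ⟨⟨A, hA, hxA⟩, B, hB, hxB⟩

lemma biUnion {α : Type*} {s : Set α} (hs : s.Finite) {f : α → Set (ι → ℝ)}
    (hf : ∀ a ∈ s, IsSemilinear (f a)) : IsSemilinear (⋃ a ∈ s, f a) := by
  induction s, hs using Set.Finite.induction_on with
  | empty => simpa using empty
  | @insert a s _ _ ih =>
    rw [Set.biUnion_insert]
    exact (hf a (Set.mem_insert a s)).union (ih fun b hb => hf b (Set.mem_insert_of_mem a hb))

lemma biInter {α : Type*} {s : Set α} (hs : s.Finite) {f : α → Set (ι → ℝ)}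
    (hf : ∀ a ∈ s, IsSemilinear (f a)) : IsSemilinear (⋂ a ∈ s, f a) := by
  induction s, hs using Set.Finite.induction_on with
  | empty => simpa using univ
  | @insert a s _ _ ih =>
    rw [Set.biInter_insert]
    exact (hf a (Set.mem_insert a s)).inter (ih fun b hb => hf b (Set.mem_insert_of_mem a hb))

lemma exists_mem {α : Type*} [Finite α] {p : α → (ι → ℝ) → Prop}
    (hp : ∀ a, IsSemilinear {x | p a x}) : IsSemilinear {x | ∃ a, p a x} := by
  convert biUnion Set.finite_univ fun a _ => hp a using 1
  ext x; simp

lemma forall_mem {α : Type*} [Finite α] {p : α → (ι → ℝ) → Prop}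
    (hp : ∀ a, IsSemilinear {x | p a x}) : IsSemilinear {x | ∀ a, p a x} := by
  convert biInter Set.finite_univ fun a _ => hp a using 1
  ext x; simp

lemma imp {p : Prop} {q : (ι → ℝ) → Prop} (hq : IsSemilinear {x | q x}) :
    IsSemilinear {x | p → q x} := by
  by_cases hp : p
  · simpa [hp] using hq
  · simpa [hp] using univ

lemma compl {S : Set (ι → ℝ)} (hS : IsSemilinear S) : IsSemilinear Sᶜ := by
  obtain ⟨G, hG, h, rfl⟩ := hS
  have : (⋃₀ G)ᶜ = ⋂ B ∈ G, Bᶜ := by ext x; simp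
  rw [this]
  refine biInter hG fun B hB => ?_
  obtain ⟨F, hF, h', rfl⟩ := h B hB
  have : (⋂₀ F)ᶜ = ⋃ H ∈ F, Hᶜ := by ext x; simp
  rw [this]
  exact biUnion hF fun H hH => (h' H hH).compl.isSemilinear

lemma eq {f g : (ι → ℝ) → ℝ} (hf : IsRatAffine f) (hg : IsRatAffine g) :
    IsSemilinear {x | f x = g x} := by
  convert (le hf hg).inter (le hg hf) using 1
  ext x
  exact le_antisymm_iff

lemma preimage {S : Set (κ → ℝ)} (hS : IsSemilinear S) {φ : (ι → ℝ) → κ → ℝ}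
    (hφ : ∀ j, IsRatAffine fun x => φ x j) : IsSemilinear (φ ⁻¹' S) := by
  obtain ⟨G, hG, h, rfl⟩ := hS
  rw [Set.preimage_sUnion]
  refine biUnion hG fun B hB => ?_
  obtain ⟨F, hF, h', rfl⟩ := h B hB
  rw [Set.preimage_sInter]
  exact biInter hF fun H hH => ((h' H hH).preimage hφ).isSemilinear

end IsSemilinear

/-- The solutions `t` of a strict or non-strict inequality `s < 0` or `s ≤ 0`. -/
def negOrNonpos (strict : Bool) (s : ℝ) : Prop := if strict then s < 0 else s ≤ 0

lemma exists_negOrNonpos_and_of_mul_pos {a b : ℝ} (h : 0 < a * b) (u v : ℝ) (σ τ : Bool) :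
    ∃ t, negOrNonpos σ (a * t + u) ∧ negOrNonpos τ (b * t + v) := by
  rcases (mul_pos_iff.1 h) with ⟨ha, hb⟩ | ⟨ha, hb⟩
  · refine ⟨min (-u / a) (-v / b) - 1, ?_, ?_⟩
    · have := (le_div_iff₀' ha).1 (min_le_left (-u / a) (-v / b))
      unfold negOrNonpos; split_ifs <;> linarith
    · have := (le_div_iff₀' hb).1 (min_le_right (-u / a) (-v / b))
      unfold negOrNonpos; split_ifs <;> linarith
  · refine ⟨max (-u / a) (-v / b) + 1, ?_, ?_⟩
    · have := (div_le_iff_of_neg' ha).1 (le_max_left (-u / a) (-v / b))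
      unfold negOrNonpos; split_ifs <;> linarith
    · have := (div_le_iff_of_neg' hb).1 (le_max_right (-u / a) (-v / b))
      unfold negOrNonpos; split_ifs <;> linarith

lemma exists_negOrNonpos_and_iff {a b : ℝ} (ha : 0 < a) (hb : b < 0) (u v : ℝ) (σ τ : Bool) :
    (∃ t, negOrNonpos σ (a * t + u) ∧ negOrNonpos τ (b * t + v)) ↔
      negOrNonpos (σ || τ) (a * v - b * u) := by
  constructor
  · rintro ⟨t, h₁, h₂⟩
    have h : a * v - b * u = a * (b * t + v) + -b * (a * t + u) := by ring
    have hb' : 0 < -b := neg_pos.2 hb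
    rw [h]
    cases σ <;> cases τ <;>
      simp only [negOrNonpos, Bool.or_true, Bool.or_false, if_true, Bool.false_eq_true,
        if_false] at h₁ h₂ ⊢ <;> nlinarith
  · intro h
    have h₁ : a * ((-u / a + -v / b) / 2) + u = (a * v - b * u) * (-(2 * b))⁻¹ := by
      have := hb.ne
      have := ha.ne'
      field_simp
      ring
    have h₂ : b * ((-u / a + -v / b) / 2) + v = (a * v - b * u) * (2 * a)⁻¹ := by
      have := hb.ne
      have := ha.ne'
      field_simp
      ring
    have hb' : 0 < (-(2 * b))⁻¹ := inv_pos.2 (by linarith)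
    have ha' : 0 < (2 * a)⁻¹ := inv_pos.2 (by linarith)
    refine ⟨(-u / a + -v / b) / 2, ?_, ?_⟩
    · rw [h₁]
      cases σ <;> cases τ <;>
        simp only [negOrNonpos, Bool.or_true, Bool.or_false, if_true, Bool.false_eq_true,
          if_false] at h ⊢ <;> nlinarith
    · rw [h₂]
      cases σ <;> cases τ <;>
        simp only [negOrNonpos, Bool.or_true, Bool.or_false, if_true, Bool.false_eq_true,
          if_false] at h ⊢ <;> nlinarith

lemma exists_negOrNonpos {a : ℝ} (h : a ≠ 0) (u : ℝ) (σ : Bool) :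
    ∃ t, negOrNonpos σ (a * t + u) := by
  obtain ⟨t, ht, -⟩ := exists_negOrNonpos_and_of_mul_pos (mul_self_pos.2 h) u u σ σ
  exact ⟨t, ht⟩

lemma isRatHalfspace_iff {H : Set (ι → ℝ)} :
    IsRatHalfspace H ↔ ∃ f σ, IsRatAffine f ∧ H = {x | negOrNonpos σ (f x)} := by
  simp [IsRatHalfspace, negOrNonpos, and_or_left, exists_or, or_comm]

lemma IsRatAffine.isSemilinear_negOrNonpos {f : (ι → ℝ) → ℝ} (hf : IsRatAffine f) (σ : Bool) :
    IsSemilinear {x | negOrNonpos σ (f x)} :=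
  (isRatHalfspace_iff.2 ⟨f, σ, hf, rfl⟩).isSemilinear

section Elimination

variable [DecidableEq ι]

lemma IsRatHalfspace.isSemilinear_exists_update_inter {H K : Set (ι → ℝ)}
    (hH : IsRatHalfspace H) (hK : IsRatHalfspace K) (i : ι) :
    IsSemilinear {x | ∃ t, Function.update x i t ∈ H ∧ Function.update x i t ∈ K} := by
  obtain ⟨f, σ, hf, rfl⟩ := isRatHalfspace_iff.1 hH
  obtain ⟨g, τ, hg, rfl⟩ := isRatHalfspace_iff.1 hK
  obtain ⟨a, u, hu, hfu⟩ := hf.exists_update_eq i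
  obtain ⟨b, v, hv, hgv⟩ := hg.exists_update_eq i
  change IsSemilinear {x | ∃ t, negOrNonpos σ (f (Function.update x i t)) ∧
    negOrNonpos τ (g (Function.update x i t))}
  simp only [hfu, hgv]
  have key : ∀ {a b : ℚ} {u v : (ι → ℝ) → ℝ} {σ τ : Bool}, IsRatAffine u → IsRatAffine v →
      0 < a → b < 0 → IsSemilinear {x | ∃ t : ℝ, negOrNonpos σ (a * t + u x) ∧
        negOrNonpos τ (b * t + v x)} := by
    intro a b u v σ τ hu hv ha hb
    have ha' : (0 : ℝ) < a := by exact_mod_cast ha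
    have hb' : (b : ℝ) < 0 := by exact_mod_cast hb
    simp only [exists_negOrNonpos_and_iff ha' hb']
    exact ((hv.const_mul a).sub (hu.const_mul b)).isSemilinear_negOrNonpos _
  have pos : 0 < (a : ℝ) * b → IsSemilinear {x | ∃ t : ℝ, negOrNonpos σ (a * t + u x) ∧
        negOrNonpos τ (b * t + v x)} := fun h => by
    simpa only [exists_negOrNonpos_and_of_mul_pos h, Set.ofPred_true] using IsSemilinear.univ
  rcases lt_trichotomy a 0 with ha | rfl | ha
  · rcases lt_trichotomy b 0 with hb | rfl | hb
    · exact pos (by exact_mod_cast mul_pos_of_neg_of_neg ha hb)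
    · have ha' : (a : ℝ) ≠ 0 := by exact_mod_cast ha.ne
      simpa [exists_negOrNonpos ha'] using hv.isSemilinear_negOrNonpos τ
    · simpa only [and_comm] using key hv hu hb ha
  · by_cases hb : b = 0
    · simpa [hb, Set.ofPred_and] using
        (hu.isSemilinear_negOrNonpos σ).inter (hv.isSemilinear_negOrNonpos τ)
    · have hb' : (b : ℝ) ≠ 0 := by exact_mod_cast hb
      simpa [exists_negOrNonpos hb'] using hu.isSemilinear_negOrNonpos σ
  · rcases lt_trichotomy b 0 with hb | rfl | hb
    · exact key hu hv ha hb
    · have ha' : (a : ℝ) ≠ 0 := by exact_mod_cast ha.ne'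
      simpa [exists_negOrNonpos ha'] using hv.isSemilinear_negOrNonpos τ
    · exact pos (by exact_mod_cast mul_pos ha hb)

lemma IsRatHalfspace.convex_setOf_update_mem {H : Set (ι → ℝ)} (hH : IsRatHalfspace H)
    (x : ι → ℝ) (i : ι) : Convex ℝ {t : ℝ | Function.update x i t ∈ H} := by
  obtain ⟨f, σ, hf, rfl⟩ := isRatHalfspace_iff.1 hH
  obtain ⟨a, u, hu, hfu⟩ := hf.exists_update_eq i
  change Convex ℝ {t : ℝ | negOrNonpos σ (f (Function.update x i t))}
  simp only [hfu]
  intro s hs t ht p q hp hq hpq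
  have h : (a : ℝ) * (p * s + q * t) + u x = p * (a * s + u x) + q * (a * t + u x) := by
    linear_combination -u x * hpq
  have hs' : negOrNonpos σ (a * s + u x) := hs
  have ht' : negOrNonpos σ (a * t + u x) := ht
  change negOrNonpos σ (a * (p * s + q * t) + u x)
  rw [h]
  cases σ
  · exact convex_Iic (0 : ℝ) hs' ht' hp hq hpq
  · exact convex_Iio (0 : ℝ) hs' ht' hp hq hpq

/-- Fourier–Motzkin elimination, by Helly's theorem on the line. -/
lemma IsRatPolyhedron.isSemilinear_exists_update {B : Set (ι → ℝ)} (hB : IsRatPolyhedron B)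
    (i : ι) : IsSemilinear {x | ∃ t, Function.update x i t ∈ B} := by
  obtain ⟨F, hF, h, rfl⟩ := hB
  have : {x | ∃ t, Function.update x i t ∈ ⋂₀ F} =
      ⋂ H ∈ F, ⋂ K ∈ F, {x | ∃ t, Function.update x i t ∈ H ∧ Function.update x i t ∈ K} := by
    ext x
    simp only [Set.mem_iInter]
    constructor
    · rintro ⟨t, ht⟩ H hH K hK
      exact ⟨t, ht H hH, ht K hK⟩
    · intro hx
      have := Convex.helly_theorem' (𝕜 := ℝ) (s := hF.toFinset)
        (F := fun H => {t : ℝ | Function.update x i t ∈ H})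
        (fun H hH => (h H (hF.mem_toFinset.1 hH)).convex_setOf_update_mem x i) ?_
      · obtain ⟨t, ht⟩ := this
        simp only [Set.mem_iInter] at ht
        exact ⟨t, fun H hH => ht H (hF.mem_toFinset.2 hH)⟩
      · intro I hI hcard
        have hmem : ∀ H ∈ I, H ∈ F := fun H hH => hF.mem_toFinset.1 (hI hH)
        simp only [Module.finrank_self, Nat.reduceAdd] at hcard
        rcases I.eq_empty_or_nonempty with rfl | ⟨H, hH⟩
        · simp
        obtain ⟨K, hK, hIK⟩ : ∃ K ∈ I, ∀ L ∈ I, L = H ∨ L = K := by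
          by_contra! hne
          obtain ⟨K, hK, hKH, -⟩ := hne H hH
          obtain ⟨L, hL, hLH, hLK⟩ := hne K hK
          have := Finset.two_lt_card.2 ⟨H, hH, K, hK, L, hL, hKH.symm, hLH.symm, hLK.symm⟩
          omega
        obtain ⟨t, htH, htK⟩ := hx H (hmem H hH) K (hmem K hK)
        refine ⟨t, Set.mem_iInter₂.2 fun L hL => ?_⟩
        rcases hIK L hL with rfl | rfl
        · exact htH
        · exact htK
  rw [this]
  exact IsSemilinear.biInter hF fun H hH => IsSemilinear.biInter hF fun K hK =>
    (h H hH).isSemilinear_exists_update_inter (h K hK) i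

lemma IsSemilinear.exists_update {S : Set (ι → ℝ)} (hS : IsSemilinear S) (i : ι) :
    IsSemilinear {x | ∃ t, Function.update x i t ∈ S} := by
  obtain ⟨G, hG, h, rfl⟩ := hS
  have : {x | ∃ t, Function.update x i t ∈ ⋃₀ G} =
      ⋃ B ∈ G, {x | ∃ t, Function.update x i t ∈ B} := by
    ext x
    simp only [Set.mem_iUnion]
    constructor
    · rintro ⟨t, B, hB, ht⟩
      exact ⟨B, hB, t, ht⟩
    · rintro ⟨B, hB, t, ht⟩
      exact ⟨t, B, hB, ht⟩
  rw [this]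
  exact IsSemilinear.biUnion hG fun B hB => (h B hB).isSemilinear_exists_update i

lemma IsSemilinear.exists_eqOn_compl {S : Set (ι → ℝ)} (hS : IsSemilinear S) (s : Finset ι) :
    IsSemilinear {x | ∃ y ∈ S, ∀ i ∉ s, y i = x i} := by
  induction s using Finset.induction_on with
  | empty =>
    convert hS using 1
    ext x
    constructor
    · rintro ⟨y, hy, h⟩
      obtain rfl : y = x := funext fun i => h i (by simp)
      exact hy
    · exact fun hx => ⟨x, hx, fun _ _ => rfl⟩
  | insert i s hi ih =>
    convert ih.exists_update i using 1
    ext x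
    constructor
    · rintro ⟨y, hy, h⟩
      refine ⟨y i, y, hy, fun j hj => ?_⟩
      by_cases hji : j = i
      · subst hji; simp
      · rw [Function.update_of_ne hji]
        exact h j (by simp [hji, hj])
    · rintro ⟨t, y, hy, h⟩
      refine ⟨y, hy, fun j hj => ?_⟩
      rw [Finset.mem_insert, not_or] at hj
      rw [h j hj.2, Function.update_of_ne hj.1]

end Elimination

/-- The projection of a semilinear set along some of the coordinates is semilinear. -/
lemma IsSemilinear.exists_sumElim {S : Set (ι ⊕ κ → ℝ)} (hS : IsSemilinear S) :
    IsSemilinear {x : ι → ℝ | ∃ y : κ → ℝ, Sum.elim x y ∈ S} := by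
  classical
  have := (hS.exists_eqOn_compl (Finset.univ.image Sum.inr)).preimage
    (φ := fun x : ι → ℝ => Sum.elim x 0) (fun j => by
      cases j with
      | inl i => exact IsRatAffine.coord i
      | inr j => exact IsRatAffine.zero)
  convert this using 1
  ext x
  constructor
  · rintro ⟨y, hy⟩
    refine ⟨_, hy, fun j hj => ?_⟩
    cases j with
    | inl i => rfl
    | inr j => simp at hj
  · rintro ⟨z, hz, h⟩
    refine ⟨z ∘ Sum.inr, ?_⟩
    convert hz using 1
    ext j
    cases j with
    | inl i => exact (h (Sum.inl i) (by simp)).symm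
    | inr j => rfl

end Semilinear

lemma IsRationalPolyhedralCone.isSemilinear {d : ℕ} {C : Set (Fin d → ℝ)}
    (hC : IsRationalPolyhedralCone C) : IsSemilinear C := by
  obtain ⟨k, v, hv, rfl⟩ := hC
  choose z hz using hv
  have h : IsSemilinear {y : Fin d ⊕ Fin k → ℝ | (∀ i, 0 ≤ y (Sum.inr i)) ∧
      ∀ j, y (Sum.inl j) = ∑ i, ((z i j : ℚ) : ℝ) * y (Sum.inr i)} :=
    (IsSemilinear.forall_mem fun i => .le .zero (.coord _)).inter
      (IsSemilinear.forall_mem fun j =>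
        .eq (.coord _) (.sum _ fun i => (IsRatAffine.coord _).const_mul _))
  convert h.exists_sumElim using 1
  ext x
  simp [funext_iff, hz, mul_comm]

lemma IsRationalPolytope.isSemilinear {d : ℕ} {P : Set (Fin d → ℝ)}
    (hP : IsRationalPolytope P) : IsSemilinear P := by
  obtain ⟨k, v, hv, rfl⟩ := hP
  choose z hz using hv
  have h : IsSemilinear {y : Fin d ⊕ Fin k → ℝ | (∀ i, 0 ≤ y (Sum.inr i)) ∧
      ∑ i, y (Sum.inr i) = 1 ∧ ∀ j, y (Sum.inl j) = ∑ i, (z i j : ℝ) * y (Sum.inr i)} :=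
    (IsSemilinear.forall_mem fun i => .le .zero (.coord _)).inter
      ((IsSemilinear.eq (.sum _ fun i => .coord _) .one).inter
        (IsSemilinear.forall_mem fun j =>
          .eq (.coord _) (.sum _ fun i => (IsRatAffine.coord _).const_mul _)))
  convert h.exists_sumElim using 1
  rw [convexHull_range_eq_exists_affineCombination]
  ext x
  constructor
  · rintro ⟨s, w, hw₀, hw₁, rfl⟩
    rw [s.affineCombination_eq_linear_combination v w hw₁]
    refine ⟨fun i => if i ∈ s then w i else 0, fun i => ?_, ?_, fun j => ?_⟩
    · change (0 : ℝ) ≤ if i ∈ s then w i else 0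
      split_ifs with hi
      exacts [hw₀ i hi, le_rfl]
    · simpa using hw₁
    · simp [hz, mul_comm]
  · rintro ⟨w, hw₀, hw₁, hw⟩
    refine ⟨Finset.univ, w, fun i _ => hw₀ i, hw₁, ?_⟩
    rw [Finset.univ.affineCombination_eq_linear_combination v w hw₁]
    ext j
    exact .trans (by simp [hz, mul_comm]) (hw j).symm

lemma IsRationalPolytope.isBounded {d : ℕ} {P : Set (Fin d → ℝ)}
    (hP : IsRationalPolytope P) : Bornology.IsBounded P := by
  obtain ⟨k, v, -, rfl⟩ := hP
  exact isBounded_convexHull.2 (Set.finite_range v).isBounded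

lemma isSemilinear_uncurry_affineSRSet {d n : ℕ} {C P : Set (Fin d → ℝ)}
    (hC : IsSemilinear C) (hP : IsSemilinear P) (τ : Fin n → Fin n → Option (Fin n)) :
    IsSemilinear {x : Fin n × Fin d → ℝ | Function.curry x ∈ AffineSRSet d n C P τ} := by
  have hcoord (i : Fin n) (j : Fin d) :
      IsRatAffine fun x : Fin n × Fin d → ℝ => Function.curry x i j := .coord (i, j)
  have hmem (S : Set (Fin d → ℝ)) (hS : IsSemilinear S) (i : Fin n) :
      IsSemilinear {x : Fin n × Fin d → ℝ | Function.curry x i ∈ S} :=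
    hS.preimage (hcoord i)
  have hadd (S : Set (Fin d → ℝ)) (hS : IsSemilinear S) (i j : Fin n) :
      IsSemilinear {x : Fin n × Fin d → ℝ | Function.curry x i + Function.curry x j ∈ S} :=
    hS.preimage fun l => (hcoord i l).add (hcoord j l)
  have hzero : IsSemilinear ({0} : Set (Fin d → ℝ)) := by
    convert IsSemilinear.forall_mem fun j : Fin d =>
      IsSemilinear.eq (.coord j) (IsRatAffine.zero (ι := Fin d)) using 1
    ext x
    exact funext_iff
  refine .inter ?_ (.inter ?_ (.inter ?_ (.inter ?_ ?_)))
  · exact .forall_mem fun i => .forall_mem fun j => .imp <| .exists_mem fun l =>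
      .inter (.forall_mem fun l' => .imp (.eq (hcoord i l') (hcoord j l')))
        (.lt (hcoord i l) (hcoord j l))
  · exact .forall_mem fun i => .inter (hmem C hC i) (hmem _ hzero.compl i)
  · exact .forall_mem fun i => hmem P hP i
  · refine .forall_mem fun i => .forall_mem fun j => .forall_mem fun k => .imp ?_
    simp only [funext_iff]
    exact .forall_mem fun l => .eq ((hcoord i l).add (hcoord j l)) (hcoord k l)
  · exact .forall_mem fun i => .forall_mem fun j => .imp (hadd _ hP.compl i j)

lemma IsRatPolyhedron.exists_inequalities {n d : ℕ} {B : Set (Fin n × Fin d → ℝ)}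
    (hB : IsRatPolyhedron B) :
    ∃ (k : ℕ) (a : Fin k → Fin n → Fin d → ℚ) (b : Fin k → ℚ) (strict : Fin k → Bool),
      {x : Fin n → Fin d → ℝ | Function.uncurry x ∈ B} =
        {x : Fin n → Fin d → ℝ | ∀ l : Fin k,
          if strict l then (∑ p, ∑ q, (a l p q : ℝ) * x p q) < (b l : ℝ)
          else (∑ p, ∑ q, (a l p q : ℝ) * x p q) ≤ (b l : ℝ)} := by
  obtain ⟨F, hF, h, rfl⟩ := hB
  have h' : ∀ H ∈ F, ∃ (a : Fin n × Fin d → ℚ) (b : ℚ) (strict : Bool),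
      ∀ x : Fin n → Fin d → ℝ, Function.uncurry x ∈ H ↔
        if strict then (∑ p, ∑ q, (a (p, q) : ℝ) * x p q) < (b : ℝ)
        else (∑ p, ∑ q, (a (p, q) : ℝ) * x p q) ≤ (b : ℝ) := by
    intro H hH
    obtain ⟨f, σ, ⟨a, b, hf⟩, rfl⟩ := isRatHalfspace_iff.1 (h H hH)
    refine ⟨a, -b, σ, fun x => ?_⟩
    change negOrNonpos σ (f (Function.uncurry x)) ↔ _
    rw [hf, Fintype.sum_prod_type]
    cases σ <;>
      simp [negOrNonpos, Function.uncurry, lt_neg_iff_add_neg, le_neg_iff_add_nonpos_right]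
  choose! a b strict hx using h'
  have := hF.to_subtype
  obtain ⟨k, ⟨e⟩⟩ := Finite.exists_equiv_fin F
  refine ⟨k, fun l p q => a (e.symm l) (p, q), fun l => b (e.symm l),
    fun l => strict (e.symm l), ?_⟩
  ext x
  calc Function.uncurry x ∈ ⋂₀ F ↔ ∀ H : F, Function.uncurry x ∈ (H : Set _) := by simp
    _ ↔ ∀ l, Function.uncurry x ∈ (e.symm l : Set _) := e.symm.forall_congr_right.symm
    _ ↔ _ := forall_congr' fun l => hx _ (e.symm l).2 x

/-- `P_τ^{(C,P)}` is a finite union of bounded sets, each cut out by finitely many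
rational linear inequalities, each strict or non-strict (i.e. rational polytopes with
mixed open and closed faces). -/
theorem affine_sr_set_is_finite_union_of_polytopes
    (d n : ℕ) (hd : 0 < d) (hn : 0 < n)
    (C P : Set (Fin d → ℝ)) (hC : IsRationalPolyhedralCone C) (hCpt : IsPointed C)
    (hP : IsCCompatible C P) (τ : Fin n → Fin n → Option (Fin n)) :
    ∃ (m : ℕ) (Q : Fin m → Set (Fin n → Fin d → ℝ)),
      AffineSRSet d n C P τ = ⋃ i, Q i ∧
      ∀ i, Bornology.IsBounded (Q i) ∧
        ∃ (k : ℕ) (a : Fin k → Fin n → Fin d → ℚ) (b : Fin k → ℚ)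
          (strict : Fin k → Bool),
          Q i = {x : Fin n → Fin d → ℝ | ∀ l : Fin k,
            if strict l then (∑ p, ∑ q, (a l p q : ℝ) * x p q) < (b l : ℝ)
            else (∑ p, ∑ q, (a l p q : ℝ) * x p q) ≤ (b l : ℝ)} := by
  have hbdd : Bornology.IsBounded (AffineSRSet d n C P τ) :=
    (Bornology.IsBounded.pi fun _ => hP.1.isBounded).subset
      fun x hx => Set.mem_univ_pi.2 hx.2.2.1
  obtain ⟨G, hG, h, hS⟩ :=
    isSemilinear_uncurry_affineSRSet hC.isSemilinear hP.1.isSemilinear τ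
  have := hG.to_subtype
  obtain ⟨m, ⟨e⟩⟩ := Finite.exists_equiv_fin G
  have hunion : AffineSRSet d n C P τ =
      ⋃ i, {x : Fin n → Fin d → ℝ | Function.uncurry x ∈ (e.symm i : Set _)} := by
    ext x
    calc x ∈ AffineSRSet d n C P τ ↔ Function.uncurry x ∈ ⋃₀ G := by rw [← hS]; rfl
      _ ↔ ∃ B : G, Function.uncurry x ∈ (B : Set _) := by simp
      _ ↔ ∃ i, Function.uncurry x ∈ (e.symm i : Set _) := e.symm.exists_congr_right.symm
      _ ↔ _ := by simp
  refine ⟨m, _, hunion, fun i => ⟨hbdd.subset ?_, (h _ (e.symm i).2).exists_inequalities⟩⟩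
  rw [hunion]
  exact Set.subset_iUnion (fun i => {x : Fin n → Fin d → ℝ |
    Function.uncurry x ∈ (e.symm i : Set (Fin n × Fin d → ℝ))}) i
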